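/- Given δ > 0, there exist T > 0, τ₀ > 0, a constant δ̃ with 0 < δ̃ ≤ δ, and an index k₀ with τ₀ + 2T < t₀/ε_{k₀}, such that for every sequence of maps {h_i}_{i≥0} ⊂ O(g) satisfying d(g·(τ₀+iT), h_i) < δ̃ for all i ≥ 0, for every k ≥ k₀, every i ≥ 0, and every τ ∈ [τ₀+(i+1)T, τ₀+(i+2)T] ∩ [τ₀+T, t₀/ε_k] (if this intersection is nonempty), one has dist(y_{ε_k}(τ), A_{(h_i·(τ−τ₀−iT), x₀(ε_kτ))}[δ]) ≤ δ. -/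

import Mathlib

open Filter Topology Metric Set

noncomputable section

/-- The time-translate h·s of a map, as a continuous map. -/
def timeTranslate {n m : ℕ} (s : ℝ)
    (h : C(EuclideanSpace ℝ (Fin n) × EuclideanSpace ℝ (Fin m) × ℝ,
      EuclideanSpace ℝ (Fin m))) :
    C(EuclideanSpace ℝ (Fin n) × EuclideanSpace ℝ (Fin m) × ℝ,
      EuclideanSpace ℝ (Fin m)) :=
  ⟨fun p => h (p.1, p.2.1, p.2.2 + s), h.continuous.comp (by fun_prop)⟩

/-- Admissibility: bounded and uniformly continuous on K × ℝ for every compact K. -/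
def IsAdmissibleMap {n m : ℕ}
    (g : C(EuclideanSpace ℝ (Fin n) × EuclideanSpace ℝ (Fin m) × ℝ,
      EuclideanSpace ℝ (Fin m))) : Prop :=
  ∀ K : Set (EuclideanSpace ℝ (Fin n) × EuclideanSpace ℝ (Fin m)), IsCompact K →
    (∃ C : ℝ, ∀ x y (τ : ℝ), (x, y) ∈ K → ‖g (x, y, τ)‖ ≤ C) ∧
    (∀ ε > (0:ℝ), ∃ δ > (0:ℝ), ∀ x y (τ : ℝ) x' y' (τ' : ℝ), (x, y) ∈ K → (x', y') ∈ K →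
      dist ((x, y, τ) : EuclideanSpace ℝ (Fin n) × EuclideanSpace ℝ (Fin m) × ℝ)
        (x', y', τ') < δ → dist (g (x, y, τ)) (g (x', y', τ')) < ε)

/-- Uniform Lipschitz continuity in y on compact sets. -/
def IsLipschitzInY {n m : ℕ}
    (g : C(EuclideanSpace ℝ (Fin n) × EuclideanSpace ℝ (Fin m) × ℝ,
      EuclideanSpace ℝ (Fin m))) : Prop :=
  ∀ K₀ : Set (EuclideanSpace ℝ (Fin n)), IsCompact K₀ →
    ∀ K : Set (EuclideanSpace ℝ (Fin m)), IsCompact K →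
      ∃ L > (0:ℝ), ∀ x ∈ K₀, ∀ y₁ ∈ K, ∀ y₂ ∈ K, ∀ τ : ℝ,
        ‖g (x, y₁, τ) - g (x, y₂, τ)‖ ≤ L * ‖y₁ - y₂‖

/-- The compact tubular neighbourhood K₀ of the slow limit x₀. -/
def slowTube {n : ℕ} (x0 : ℝ → EuclideanSpace ℝ (Fin n)) (t₀ r : ℝ) :
    Set (EuclideanSpace ℝ (Fin n)) :=
  {z | ∃ t ∈ Set.Icc (0:ℝ) t₀, ∃ v : EuclideanSpace ℝ (Fin n), ‖v‖ ≤ r ∧ z = x0 t + v}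

/-- The fiber A_{(h,x)}: initial values of bounded entire solutions of y' = h(x,y,τ). -/
def attrFiber {n m : ℕ} {H : Type*}
    (ev : H → C(EuclideanSpace ℝ (Fin n) × EuclideanSpace ℝ (Fin m) × ℝ,
      EuclideanSpace ℝ (Fin m)))
    (h : H) (x : EuclideanSpace ℝ (Fin n)) : Set (EuclideanSpace ℝ (Fin m)) :=
  {z | ∃ y : ℝ → EuclideanSpace ℝ (Fin m), y 0 = z ∧ (∃ C, ∀ τ : ℝ, ‖y τ‖ ≤ C) ∧
    ∀ τ : ℝ, HasDerivAt y (ev h (x, y τ, τ)) τ}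

/-- The parametrically inflated fiber A_{(h,x)}[δ] over the base H × K₀. -/
def inflFiber {n m : ℕ} {H : Type*} [MetricSpace H]
    (ev : H → C(EuclideanSpace ℝ (Fin n) × EuclideanSpace ℝ (Fin m) × ℝ,
      EuclideanSpace ℝ (Fin m)))
    (K₀ : Set (EuclideanSpace ℝ (Fin n)))
    (h : H) (x : EuclideanSpace ℝ (Fin n)) (δ : ℝ) : Set (EuclideanSpace ℝ (Fin m)) :=
  ⋃ p ∈ {p : H × EuclideanSpace ℝ (Fin n) |
    p.2 ∈ K₀ ∧ max (dist h p.1) (dist x p.2) ≤ δ}, attrFiber ev p.1 p.2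

/-- The inflated fiber Aˣ_h[δ] (inflation only in the hull variable). -/
def inflFiberH {n m : ℕ} {H : Type*} [MetricSpace H]
    (ev : H → C(EuclideanSpace ℝ (Fin n) × EuclideanSpace ℝ (Fin m) × ℝ,
      EuclideanSpace ℝ (Fin m)))
    (h : H) (x : EuclideanSpace ℝ (Fin n)) (δ : ℝ) : Set (EuclideanSpace ℝ (Fin m)) :=
  ⋃ h' ∈ {h' : H | dist h' h ≤ δ}, attrFiber ev h' x

/-- The omega-limit set O(g₀) of g₀ for the flow σf. -/
def omegaSet {H : Type*} [TopologicalSpace H] (σf : ℝ → H → H) (g0 : H) : Set H :=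
  ⋂ s ∈ Set.Ici (0:ℝ), closure {h : H | ∃ τ ≥ s, h = σf τ g0}

/-- The parametrically inflated fiber over the base O(g) × K₀. -/
def inflFiberO {n m : ℕ} {H : Type*} [MetricSpace H]
    (ev : H → C(EuclideanSpace ℝ (Fin n) × EuclideanSpace ℝ (Fin m) × ℝ,
      EuclideanSpace ℝ (Fin m)))
    (σf : ℝ → H → H) (g0 : H)
    (K₀ : Set (EuclideanSpace ℝ (Fin n)))
    (h : H) (x : EuclideanSpace ℝ (Fin n)) (δ : ℝ) : Set (EuclideanSpace ℝ (Fin m)) :=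
  ⋃ p ∈ {p : H × EuclideanSpace ℝ (Fin n) |
    p.1 ∈ omegaSet σf g0 ∧ p.2 ∈ K₀ ∧ max (dist h p.1) (dist x p.2) ≤ δ},
      attrFiber ev p.1 p.2

end

theorem lt_of_forall_Ico_lt {φ : ℝ → ℝ} {S c : ℝ} (hφ : ContinuousOn φ (Icc 0 S))
    (step : ∀ t ∈ Icc 0 S, (∀ s ∈ Ico 0 t, φ s < c) → φ t < c) :
    ∀ t ∈ Icc 0 S, φ t < c := by
  by_contra! hcon
  obtain ⟨t, ht, hct⟩ := hcon
  have hclosed : IsClosed (Icc 0 S ∩ φ ⁻¹' Ici c) :=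
    hφ.preimage_isClosed_of_isClosed isClosed_Icc isClosed_Ici
  have hbdd : BddBelow (Icc 0 S ∩ φ ⁻¹' Ici c) := ⟨0, fun s hs => hs.1.1⟩
  obtain ⟨hmem, hle⟩ := hclosed.csInf_mem ⟨t, ht, hct⟩ hbdd
  refine (step _ hmem fun s hs => ?_).not_ge hle
  by_contra! hs'
  exact (csInf_le hbdd ⟨⟨hs.1, hs.2.le.trans hmem.2⟩, hs'⟩).not_gt hs.2

theorem tendsto_gronwallBound_zero (K T : ℝ) :
    Tendsto (fun q : ℝ => gronwallBound q K (q + q) T) (𝓝 0) (𝓝 0) := by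
  have hc : Continuous fun q : ℝ => gronwallBound q K (q + q) T := by
    unfold gronwallBound
    split_ifs <;> fun_prop
  simpa [gronwallBound_ε0_δ0] using hc.tendsto 0

section ContinuousDependence

variable {E F : Type*} [NormedAddCommGroup E] [NormedAddCommGroup F] [NormedSpace ℝ F]

/-- Solutions of `u' = h'(ξ(s), u, s)` depend continuously on `h'` (compact-open topology), on the
parameter curve `ξ` near a constant `x`, and on the initial value. -/
theorem exists_nhds_dist_solution_lt [ProperSpace E] [ProperSpace F] (h : C(E × F × ℝ, F)) {x : E}
    (hL : ∀ R : ℝ, ∃ L : NNReal, ∀ t, LipschitzOnWith L (fun y => h (x, y, t)) (closedBall 0 R))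
    {v : ℝ → F} {T : ℝ} (hv : ∀ s ∈ Icc 0 T, HasDerivAt v (h (x, v s, s)) s)
    {η : ℝ} (hη : 0 < η) :
    ∃ U ∈ 𝓝 h, ∃ ρ > (0 : ℝ), ∀ h' ∈ U, ∀ S ≤ T, ∀ ξ : ℝ → E,
      (∀ s ∈ Icc 0 S, dist (ξ s) x < ρ) → ∀ u : ℝ → F,
      (∀ s ∈ Icc 0 S, HasDerivAt u (h' (ξ s, u s, s)) s) → dist (u 0) (v 0) < ρ →
      ∀ s ∈ Icc 0 S, dist (u s) (v s) < η := by
  have hvc : ContinuousOn v (Icc 0 T) := fun s hs => (hv s hs).continuousAt.continuousWithinAt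
  obtain ⟨M, hM⟩ := isCompact_Icc.exists_bound_of_continuousOn hvc
  obtain ⟨L, hL⟩ := hL (M + 1)
  have hc : 0 < min η 1 := lt_min hη one_pos
  obtain ⟨q, hq, hq0⟩ : ∃ q, gronwallBound q L (q + q) T < min η 1 ∧ 0 < q :=
    (((tendsto_gronwallBound_zero L T).eventually_lt_const hc).filter_mono
      nhdsWithin_le_nhds |>.and self_mem_nhdsWithin).exists (f := 𝓝[>] (0 : ℝ))
  set K : Set (E × F × ℝ) := closedBall x 1 ×ˢ closedBall 0 (M + 1) ×ˢ Icc 0 T with hK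
  have hKc : IsCompact K :=
    (isCompact_closedBall _ _).prod ((isCompact_closedBall _ _).prod isCompact_Icc)
  obtain ⟨ρ₁, hρ₁, hρ₁'⟩ := Metric.uniformContinuousOn_iff.1
    (hKc.uniformContinuousOn_of_continuous h.continuous.continuousOn) q hq0
  have hU := Metric.tendstoUniformlyOn_iff.1
    (ContinuousMap.tendsto_iff_forall_isCompact_tendstoUniformlyOn.1
      (tendsto_id (x := 𝓝 h)) K hKc) q hq0
  refine ⟨_, hU, min q (min ρ₁ 1), by positivity, ?_⟩
  intro h' hh' S hST ξ hξ u hu hu0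
  have huc : ContinuousOn u (Icc 0 S) := fun s hs => (hu s hs).continuousAt.continuousWithinAt
  have hvS : ContinuousOn v (Icc 0 S) := hvc.mono (Icc_subset_Icc_right hST)
  suffices ∀ s ∈ Icc 0 S, dist (u s) (v s) < min η 1 from
    fun s hs => (this s hs).trans_le (min_le_left _ _)
  refine lt_of_forall_Ico_lt (continuous_dist.comp_continuousOn (huc.prodMk hvS)) fun t ht hlt => ?_
  have hmemT : ∀ s ∈ Ico 0 t, s ∈ Icc 0 T := fun s hs => ⟨hs.1, hs.2.le.trans (ht.2.trans hST)⟩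
  have hmemS : ∀ s ∈ Ico 0 t, s ∈ Icc 0 S := fun s hs => ⟨hs.1, hs.2.le.trans ht.2⟩
  have hvM : ∀ s ∈ Ico 0 t, v s ∈ closedBall (0 : F) (M + 1) := fun s hs => by
    have := hM s (hmemT s hs)
    rw [mem_closedBall_zero_iff]; linarith
  have huM : ∀ s ∈ Ico 0 t, u s ∈ closedBall (0 : F) (M + 1) := fun s hs => by
    have h1 := hM s (hmemT s hs)
    have h2 := (hlt s hs).trans_le (min_le_right _ _)
    have h3 := norm_le_norm_add_norm_sub' (u s) (v s)
    rw [← dist_eq_norm] at h3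
    rw [mem_closedBall_zero_iff]; linarith
  have key := dist_le_of_approx_trajectories_ODE_of_mem (v := fun t y => h (x, y, t))
    (s := fun _ => closedBall 0 (M + 1)) (K := L) (a := 0) (b := t) (f := u) (g := v)
    (f' := fun s => h' (ξ s, u s, s)) (g' := fun s => h (x, v s, s)) (εf := q + q) (εg := 0)
    (δ := q) (fun s _ => hL s) (huc.mono (Icc_subset_Icc_right ht.2))
    (fun s hs => (hu s (hmemS s hs)).hasDerivWithinAt) ?_ huM
    (hvS.mono (Icc_subset_Icc_right ht.2))
    (fun s hs => (hv s (hmemT s hs)).hasDerivWithinAt) (by simp) hvM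
    (hu0.le.trans (min_le_left _ _)) t (right_mem_Icc.2 ht.1)
  · rw [add_zero, sub_zero] at key
    refine key.trans_lt (lt_of_le_of_lt ?_ hq)
    exact gronwallBound_mono hq0.le (by linarith) L.coe_nonneg (ht.2.trans hST)
  · intro s hs
    have hd := hξ s (hmemS s hs)
    simp only [lt_min_iff] at hd
    have hmem : ((ξ s, u s, s) : E × F × ℝ) ∈ K :=
      ⟨hd.2.2.le, huM s hs, hmemT s hs⟩
    have hmem' : ((x, u s, s) : E × F × ℝ) ∈ K :=
      ⟨mem_closedBall_self zero_le_one, huM s hs, hmemT s hs⟩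
    have e1 : dist (h (ξ s, u s, s)) (h' (ξ s, u s, s)) < q := hh' _ hmem
    have e2 := hρ₁' _ hmem _ hmem' (by
      rw [Prod.dist_eq, Prod.dist_eq]; simpa [hρ₁] using hd.2.1)
    rw [dist_comm] at e1
    exact (dist_triangle _ _ _).trans (add_le_add e1.le e2.le)

/-- `v` solves `v' = h(x, v, s)` for all `s ≥ 0`. -/
def IsForwardSolution (h : C(E × F × ℝ, F)) (x : E) (v : ℝ → F) : Prop :=
  ∀ s, 0 ≤ s → HasDerivAt v (h (x, v s, s)) s

/-- Local Lipschitz continuity of `h(x, ·, t)`, uniform in `t`. -/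
def IsLocallyUniformlyLipschitz (h : C(E × F × ℝ, F)) : Prop :=
  ∀ (x : E) (R : ℝ), ∃ L : NNReal, ∀ t, LipschitzOnWith L (fun y => h (x, y, t)) (closedBall 0 R)

variable [ProperSpace E] [ProperSpace F]

theorem IsForwardSolution.eq_of_eq_zero {h : C(E × F × ℝ, F)} {x : E} {v w : ℝ → F}
    (hL : IsLocallyUniformlyLipschitz h) (hv : IsForwardSolution h x v)
    (hw : IsForwardSolution h x w) (h0 : w 0 = v 0) {s : ℝ} (hs : 0 ≤ s) : w s = v s := by
  refine eq_of_forall_dist_le fun η hη => ?_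
  obtain ⟨U, hU, ρ, hρ, H⟩ := exists_nhds_dist_solution_lt h (hL x) (T := s)
    (fun t ht => hv t ht.1) hη
  exact (H h (mem_of_mem_nhds hU) s le_rfl (fun _ => x) (by simpa using fun _ _ _ => hρ) w
    (fun t ht => hw t ht.1) (by simpa [h0] using hρ) s ⟨hs, le_rfl⟩).le

theorem IsForwardSolution.eventually_dist_lt {h : C(E × F × ℝ, F)} {x : E} {v : ℝ → F}
    (hL : IsLocallyUniformlyLipschitz h) (hv : IsForwardSolution h x v)
    {h' : ℕ → C(E × F × ℝ, F)} (hh : Tendsto h' atTop (𝓝 h)) {T : ℝ} {S : ℕ → ℝ}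
    (hS : ∀ j, S j ≤ T) {ξ : ℕ → ℝ → E}
    (hξ : ∀ ρ > 0, ∀ᶠ j in atTop, ∀ s ∈ Icc 0 (S j), dist (ξ j s) x < ρ) {u : ℕ → ℝ → F}
    (hu : ∀ j, ∀ s ∈ Icc 0 (S j), HasDerivAt (u j) (h' j (ξ j s, u j s, s)) s)
    (hu0 : Tendsto (fun j => u j 0) atTop (𝓝 (v 0))) {η : ℝ} (hη : 0 < η) :
    ∀ᶠ j in atTop, ∀ s ∈ Icc 0 (S j), dist (u j s) (v s) < η := by
  obtain ⟨U, hU, ρ, hρ, H⟩ := exists_nhds_dist_solution_lt h (hL x) (T := T)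
    (fun t ht => hv t ht.1) hη
  filter_upwards [hh hU, hξ ρ hρ, Metric.tendsto_nhds.1 hu0 ρ hρ] with j h1 h2 h3
  exact H _ h1 _ (hS j) _ h2 _ (hu j) h3

end ContinuousDependence

/-- A family of fast trajectories `ye k`, driven by slow components `xe k` close to `x0`, over a
dissipative nonautonomous equation with compact hull. -/
structure FastFamily {E F H : Type*} [NormedAddCommGroup E] [NormedAddCommGroup F]
    [NormedSpace ℝ F] [MetricSpace H] (σ : ℝ → H → H) (ev : H → C(E × F × ℝ, F)) (g0 : H)
    (ε : ℕ → ℝ) (t₀ : ℝ) (x0 : ℝ → E) (xe : ℕ → ℝ → E) (ye : ℕ → ℝ → F) : Prop where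
  continuous_ev : Continuous ev
  continuous_flow : Continuous fun p : ℝ × H => σ p.1 p.2
  flow_add : ∀ s t h, σ (s + t) h = σ s (σ t h)
  ev_flow : ∀ s h x y t, ev (σ s h) (x, y, t) = ev h (x, y, t + s)
  lipschitz : ∀ h, IsLocallyUniformlyLipschitz (ev h)
  exists_solution : ∀ h ∈ closure {h : H | ∃ τ ≥ 0, h = σ τ g0}, ∀ x y,
    ∃ v, v 0 = y ∧ IsForwardSolution (ev h) x v
  dissipative : ∃ c : ℝ, ∀ d > 0, ∃ T > (0 : ℝ), ∀ x ∈ x0 '' Icc 0 t₀, ∀ s ≥ 0, ∀ y : F, ‖y‖ ≤ d →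
    ∃ u, u 0 = y ∧ IsForwardSolution (ev (σ s g0)) x u ∧ ∀ τ ≥ T, ‖u τ‖ ≤ c
  pos : ∀ k, 0 < ε k
  lim : Tendsto ε atTop (𝓝 0)
  hasDerivAt : ∀ k, ∀ τ ∈ Icc 0 (t₀ / ε k), HasDerivAt (ye k) (ev g0 (xe k τ, ye k τ, τ)) τ
  slow : ∀ t ∈ Icc 0 t₀, ∀ ρ > 0, ∃ κ > 0, ∀ᶠ k in atTop, ∀ τ ∈ Icc 0 (t₀ / ε k),
    dist (ε k * τ) t < κ → dist (xe k τ) (x0 t) < ρ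

namespace FastFamily

variable {E F H : Type*} [NormedAddCommGroup E] [NormedAddCommGroup F] [NormedSpace ℝ F]
  [MetricSpace H] {σ : ℝ → H → H} {ev : H → C(E × F × ℝ, F)} {g0 : H} {ε : ℕ → ℝ} {t₀ : ℝ}
  {x0 : ℝ → E} {xe : ℕ → ℝ → E} {ye : ℕ → ℝ → F}

theorem mul_mem_Icc (A : FastFamily σ ev g0 ε t₀ x0 xe ye) {k : ℕ} {s : ℝ}
    (hs : s ∈ Icc 0 (t₀ / ε k)) : ε k * s ∈ Icc 0 t₀ := by
  have := (le_div_iff₀ (A.pos k)).1 hs.2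
  exact ⟨mul_nonneg (A.pos k).le hs.1, by linarith⟩

variable [ProperSpace E] [ProperSpace F]

theorem norm_le (A : FastFamily σ ev g0 ε t₀ x0 xe ye) :
    ∃ c : ℝ, ∀ d > 0, ∃ T > (0 : ℝ), ∀ x ∈ x0 '' Icc 0 t₀,
      ∀ h ∈ closure {h : H | ∃ τ ≥ 0, h = σ τ g0}, ∀ v, IsForwardSolution (ev h) x v → ‖v 0‖ ≤ d →
      ∀ τ ≥ T, ‖v τ‖ ≤ c := by
  obtain ⟨c, hc⟩ := A.dissipative
  refine ⟨c, fun d hd => ?_⟩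
  obtain ⟨T, hT, hdiss⟩ := hc d hd
  refine ⟨T, hT, fun x hx h hh v hv hv0 τ hτ => le_of_forall_pos_le_add fun η hη => ?_⟩
  obtain ⟨U, hU, ρ, hρ, hclose⟩ := exists_nhds_dist_solution_lt (ev h) (A.lipschitz h x) (T := τ)
    (fun t ht => hv t ht.1) hη
  obtain ⟨_, hsU, s, hs, rfl⟩ := mem_closure_iff_nhds.1 hh _ (A.continuous_ev.continuousAt hU)
  obtain ⟨u, hu0, hu, huc⟩ := hdiss x hx s hs (v 0) hv0
  have := hclose _ hsU τ le_rfl (fun _ => x) (by simpa using fun _ _ _ => hρ) u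
    (fun t ht => hu t ht.1) (by simpa [hu0] using hρ) τ ⟨hT.le.trans hτ, le_rfl⟩
  have h2 := norm_le_norm_add_norm_sub' (v τ) (u τ)
  rw [← dist_eq_norm, dist_comm] at h2
  linarith [huc τ hτ]

theorem eventually_dist_lt (A : FastFamily σ ev g0 ε t₀ x0 xe ye) {κ : ℕ → ℕ}
    (hκ : Tendsto κ atTop atTop) {s : ℕ → ℝ} (hs : ∀ᶠ j in atTop, s j ∈ Icc 0 (t₀ / ε (κ j)))
    {h : H} (hh : Tendsto (fun j => σ (s j) g0) atTop (𝓝 h)) {t : ℝ} (ht : t ∈ Icc 0 t₀)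
    (hst : Tendsto (fun j => ε (κ j) * s j) atTop (𝓝 t)) {v : ℝ → F}
    (hv : IsForwardSolution (ev h) (x0 t) v)
    (hv0 : Tendsto (fun j => ye (κ j) (s j)) atTop (𝓝 (v 0))) (T : ℝ) {η : ℝ} (hη : 0 < η) :
    ∀ᶠ j in atTop, ∀ s' ∈ Icc 0 T, s j + s' ≤ t₀ / ε (κ j) →
      dist (ye (κ j) (s j + s')) (v s') < η := by
  obtain ⟨N, hN⟩ := eventually_atTop.1 hs
  have hshift : Tendsto (fun j : ℕ => j + N) atTop atTop := tendsto_add_atTop_nat N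
  have key := hv.eventually_dist_lt (A.lipschitz h)
    (h' := fun j => ev (σ (s (j + N)) g0))
    (((A.continuous_ev.tendsto h).comp hh).comp hshift) (T := T)
    (S := fun j => min T (t₀ / ε (κ (j + N)) - s (j + N))) (fun j => min_le_left _ _)
    (ξ := fun j s' => xe (κ (j + N)) (s (j + N) + s'))
    (u := fun j s' => ye (κ (j + N)) (s (j + N) + s')) ?_ ?_ ?_ hη
  · rw [← map_add_atTop_eq_nat N, eventually_map]
    filter_upwards [key] with j hj s' hs' hle
    exact hj s' ⟨hs'.1, le_min hs'.2 (by linarith)⟩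
  · intro ρ hρ
    obtain ⟨κ', hκ', hslow⟩ := A.slow t ht ρ hρ
    have h1 : Tendsto (fun j => ε (κ j) * T) atTop (𝓝 0) := by
      simpa using (A.lim.comp hκ).mul_const T
    refine hshift.eventually (p := fun j => ∀ s' ∈ Icc 0 (min T (t₀ / ε (κ j) - s j)),
      dist (xe (κ j) (s j + s')) (x0 t) < ρ) ?_
    filter_upwards [hκ.eventually hslow, hs, Metric.tendsto_nhds.1 hst (κ' / 2) (half_pos hκ'),
      h1.eventually_lt_const (half_pos hκ')] with j a1 a2 a3 a4 s' hs'
    have b1 := hs'.2.trans (min_le_left _ _)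
    have b2 := hs'.2.trans (min_le_right _ _)
    refine a1 _ ⟨add_nonneg a2.1 hs'.1, by linarith⟩ ?_
    have b3 : ε (κ j) * s' ≤ ε (κ j) * T := mul_le_mul_of_nonneg_left b1 (A.pos _).le
    have b4 : 0 ≤ ε (κ j) * s' := mul_nonneg (A.pos _).le hs'.1
    rw [Real.dist_eq, abs_lt] at a3 ⊢
    constructor <;> linarith [a3.1, a3.2, mul_add (ε (κ j)) (s j) s']
  · intro j s' hs'
    have b2 := hs'.2.trans (min_le_right _ _)
    have b3 := hN (j + N) (by omega)
    have := A.hasDerivAt (κ (j + N)) (s (j + N) + s')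
      ⟨add_nonneg b3.1 hs'.1, by linarith⟩
    rw [A.ev_flow, add_comm s']
    exact this.comp_const_add _ _
  · simpa [Function.comp_def] using hv0.comp hshift

/-- On windows of fixed length, fast trajectories shadow frozen solutions over the closed forward
orbit, with a uniform bound. -/
theorem exists_shadowing [CompactSpace H] (A : FastFamily σ ev g0 ε t₀ x0 xe ye) (d T : ℝ)
    {η : ℝ} (hη : 0 < η) :
    ∃ N : ℕ, ∀ k ≥ N, ∀ s ∈ Icc 0 (t₀ / ε k), ‖ye k s‖ ≤ d →
      ∃ h ∈ closure {h : H | ∃ τ ≥ 0, h = σ τ g0}, ∃ x ∈ x0 '' Icc 0 t₀, ∃ v,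
        IsForwardSolution (ev h) x v ∧ ‖v 0‖ ≤ d ∧ (∀ s' ∈ Icc 0 T, ‖v s'‖ ≤ N) ∧
        ∀ s' ∈ Icc 0 T, s + s' ≤ t₀ / ε k → dist (ye k (s + s')) (v s') < η := by
  by_contra! hcon
  choose κ hκ s hs hd hcon using hcon
  have hκ' : Tendsto κ atTop atTop := tendsto_atTop_mono hκ tendsto_id
  obtain ⟨⟨h, t, y⟩, ⟨-, ht, hy⟩, φ, hφ, hlim⟩ := (isCompact_univ.prod
    (isCompact_Icc.prod (isCompact_closedBall (0 : F) d))).tendsto_subseq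
    (x := fun j => ((σ (s j) g0, ε (κ j) * s j, ye (κ j) (s j)) : H × ℝ × F))
    (s := univ ×ˢ Icc 0 t₀ ×ˢ closedBall 0 d)
    (fun j => ⟨mem_univ _, A.mul_mem_Icc (hs j), by simpa using hd j⟩)
  obtain ⟨l1, l23⟩ := Prod.tendsto_iff _ _ |>.1 hlim
  obtain ⟨l2, l3⟩ := Prod.tendsto_iff _ _ |>.1 l23
  have hP : h ∈ closure {h : H | ∃ τ ≥ 0, h = σ τ g0} :=
    mem_closure_of_tendsto l1 (Eventually.of_forall fun j => ⟨_, (hs _).1, rfl⟩)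
  obtain ⟨v, hv0, hv⟩ := A.exists_solution h hP (x0 t) y
  obtain ⟨M, hM⟩ := (isCompact_Icc (a := 0) (b := T)).exists_bound_of_continuousOn
    (fun s hs => (hv s hs.1).continuousAt.continuousWithinAt)
  have key := A.eventually_dist_lt (hκ'.comp hφ.tendsto_atTop)
    (s := s ∘ φ) (Eventually.of_forall fun j => hs _) l1 ht l2 hv (by rw [hv0]; exact l3) T hη
  obtain ⟨j, hj, hjM⟩ := (key.and
    ((tendsto_natCast_atTop_atTop.comp hφ.tendsto_atTop).eventually_ge_atTop M)).exists
  obtain ⟨s', hs', hle, hfar⟩ := hcon (φ j) h hP _ ⟨t, ht, rfl⟩ v hv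
    (by simpa [hv0] using hy) fun s' hs' => (hM s' hs').trans hjM
  exact (hj s' hs' hle).not_ge hfar

theorem exists_norm_le [CompactSpace H] (A : FastFamily σ ev g0 ε t₀ x0 xe ye) {y₀ : F}
    (hy₀ : ∀ k, ye k 0 = y₀) :
    ∃ R : ℝ, ∃ N : ℕ, ∀ k ≥ N, ∀ τ ∈ Icc 0 (t₀ / ε k), ‖ye k τ‖ ≤ R := by
  obtain ⟨c, hc⟩ := A.norm_le
  set d := max 1 (max (c + 1) ‖y₀‖)
  have hd : 0 < d := lt_max_of_lt_left one_pos
  obtain ⟨T, hT, hcT⟩ := hc d hd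
  obtain ⟨N, hN⟩ := A.exists_shadowing d T one_pos
  refine ⟨N + 1, N, fun k hk τ hτ => ?_⟩
  have hstep : ∀ i : ℕ, i * T ≤ t₀ / ε k → ‖ye k (i * T)‖ ≤ d := by
    intro i
    induction i with
    | zero => intro; simp [hy₀, d]
    | succ i ih =>
      intro hi
      push_cast at hi ⊢
      rw [add_one_mul] at hi ⊢
      have hle : i * T ≤ t₀ / ε k := by linarith
      obtain ⟨h, hh, x, hx, v, hv, hv0, -, hclose⟩ :=
        hN k hk (i * T) ⟨by positivity, hle⟩ (ih hle)
      have h1 := hclose T ⟨hT.le, le_rfl⟩ hi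
      have h2 := hcT x hx h hh v hv hv0 T le_rfl
      have h3 := norm_le_norm_add_norm_sub' (ye k (i * T + T)) (v T)
      rw [← dist_eq_norm] at h3
      exact (by linarith : _ ≤ c + 1).trans ((le_max_left _ _).trans (le_max_right _ _))
  have hfl := Nat.floor_le (div_nonneg hτ.1 hT.le)
  have hlt := Nat.lt_floor_add_one (τ / T)
  rw [le_div_iff₀ hT] at hfl
  rw [div_lt_iff₀ hT, add_one_mul] at hlt
  set i := ⌊τ / T⌋₊
  have hle : i * T ≤ t₀ / ε k := hfl.trans hτ.2
  obtain ⟨h, hh, x, hx, v, hv, hv0, hvN, hclose⟩ :=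
    hN k hk (i * T) ⟨by positivity, hle⟩ (hstep i hle)
  have hmem : τ - i * T ∈ Icc 0 T := ⟨by linarith, by linarith⟩
  have h1 := hclose _ hmem (by linarith [hτ.2])
  have h2 := hvN _ hmem
  rw [add_sub_cancel] at h1
  have h3 := norm_le_norm_add_norm_sub' (ye k τ) (v (τ - i * T))
  rw [← dist_eq_norm] at h3
  linarith

/-- Forward solutions started at the times `-N`, matching at the starting times, glue to a bounded
entire solution. -/
theorem exists_entire_solution (A : FastFamily σ ev g0 ε t₀ x0 xe ye) {h : H} {x : E}
    {v : ℕ → ℝ → F} (hv : ∀ N : ℕ, IsForwardSolution (ev (σ (-N) h)) x (v N))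
    (hmatch : ∀ N N' : ℕ, N ≤ N' → v N' (N' - N) = v N 0) {c T : ℝ}
    (hbound : ∀ N, ∀ τ ≥ T, ‖v N τ‖ ≤ c) :
    ∃ y : ℝ → F, y 0 = v 0 0 ∧ (∃ C, ∀ τ, ‖y τ‖ ≤ C) ∧
      ∀ τ, HasDerivAt y (ev h (x, y τ, τ)) τ := by
  have hcons : ∀ (N N' : ℕ) (t : ℝ), N ≤ N' → 0 ≤ N + t → v N' (N' + t) = v N (N + t) := by
    intro N N' t hNN ht
    have hNN' : (N : ℝ) ≤ N' := by exact_mod_cast hNN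
    have hw : IsForwardSolution (ev (σ (-N) h)) x (fun s => v N' (s + (N' - N))) := by
      intro s hs
      have := (hv N' (s + (N' - N)) (by linarith)).comp_add_const s (N' - N : ℝ)
      rw [A.ev_flow] at this ⊢
      rwa [show s + ((N' : ℝ) - N) + -N' = s + -N by ring] at this
    have := (hv N).eq_of_eq_zero (A.lipschitz _) hw (by simpa using hmatch N N' hNN) ht
    rwa [show (N : ℝ) + t + (N' - N) = N' + t by ring] at this
  have hrep : ∀ (N : ℕ) (t : ℝ), 0 ≤ N + t → v ⌈|t|⌉₊ (⌈|t|⌉₊ + t) = v N (N + t) := by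
    intro N t ht
    have h1 : 0 ≤ (⌈|t|⌉₊ : ℝ) + t := by linarith [Nat.le_ceil |t|, neg_abs_le t]
    rcases le_total N ⌈|t|⌉₊ with h2 | h2
    · exact hcons _ _ _ h2 ht
    · exact (hcons _ _ _ h2 h1).symm
  refine ⟨fun t => v ⌈|t|⌉₊ (⌈|t|⌉₊ + t), by simp, ⟨c, fun t => ?_⟩, fun t => ?_⟩
  · obtain ⟨N, hN⟩ := exists_nat_ge (max (-t) (T - t))
    rw [max_le_iff] at hN
    simp only
    rw [hrep N t (by linarith [hN.1])]
    exact hbound _ _ (by linarith [hN.2])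
  · obtain ⟨N, hN⟩ := exists_nat_gt (-t)
    have hpos : 0 < (N : ℝ) + t := by linarith
    simp only
    rw [hrep N t hpos.le]
    have := (hv N _ hpos.le).comp_const_add (N : ℝ) t
    rw [A.ev_flow, show (N : ℝ) + t + -N = t by ring] at this
    refine this.congr_of_eventuallyEq ?_
    filter_upwards [lt_mem_nhds (show -(N : ℝ) < t by linarith)] with t' ht'
    exact hrep N t' (by linarith)

/-- After a uniform time, fast trajectories are close to bounded entire solutions of frozen
equations over the omega-limit set. -/
theorem exists_near_entire_solution [CompactSpace H] (A : FastFamily σ ev g0 ε t₀ x0 xe ye)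
    {y₀ : F} (hy₀ : ∀ k, ye k 0 = y₀) (hx0 : ContinuousOn x0 (Icc 0 t₀)) {η : ℝ} (hη : 0 < η) :
    ∃ N : ℕ, ∀ k ≥ N, ∀ τ ∈ Icc (N : ℝ) (t₀ / ε k), ∃ h ∈ omegaSet σ g0, ∃ x ∈ x0 '' Icc 0 t₀,
      dist (σ τ g0) h < η ∧ dist (x0 (ε k * τ)) x < η ∧
      ∃ z : F, dist (ye k τ) z < η ∧ ∃ y : ℝ → F, y 0 = z ∧ (∃ C, ∀ τ, ‖y τ‖ ≤ C) ∧
        ∀ τ, HasDerivAt y (ev h (x, y τ, τ)) τ := by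
  by_contra! hcon
  choose κ hκ s hs hcon using hcon
  have hκ' : Tendsto κ atTop atTop := tendsto_atTop_mono hκ tendsto_id
  have hs' : Tendsto s atTop atTop := tendsto_atTop_mono (fun j => (hs j).1)
    tendsto_natCast_atTop_atTop
  have hs0 : ∀ j, s j ∈ Icc 0 (t₀ / ε (κ j)) := fun j => ⟨j.cast_nonneg.trans (hs j).1, (hs j).2⟩
  obtain ⟨R, N₀, hR⟩ := A.exists_norm_le hy₀
  have hR0 : 0 ≤ |R| + 1 := by positivity
  obtain ⟨⟨h, t, w⟩, ⟨-, ht, hw⟩, φ, hφ, hlim⟩ := (isCompact_univ.prod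
    (isCompact_Icc.prod (isCompact_univ_pi fun _ : ℕ =>
      isCompact_closedBall (0 : F) (|R| + 1)))).tendsto_subseq
    (x := fun j => ((σ (s j) g0, ε (κ j) * s j, fun N : ℕ =>
      if N₀ ≤ κ j ∧ (N : ℝ) ≤ s j then ye (κ j) (s j - N) else 0) : H × ℝ × (ℕ → F)))
    (s := univ ×ˢ Icc 0 t₀ ×ˢ (univ.pi fun _ : ℕ => closedBall 0 (|R| + 1)))
    (fun j => ⟨mem_univ _, A.mul_mem_Icc (hs0 j), fun N _ => by
      simp only [mem_closedBall_zero_iff]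
      split_ifs with hif
      · have := hR _ hif.1 (s j - N) ⟨by linarith [hif.2], by
          linarith [(hs j).2, N.cast_nonneg (α := ℝ)]⟩
        linarith [le_abs_self R]
      · simpa using hR0⟩)
  obtain ⟨l1, l23⟩ := Prod.tendsto_iff _ _ |>.1 hlim
  obtain ⟨l2, l3⟩ := Prod.tendsto_iff _ _ |>.1 l23
  rw [tendsto_pi_nhds] at l3
  have hκφ := hκ'.comp hφ.tendsto_atTop
  have hsφ := hs'.comp hφ.tendsto_atTop
  have hev : ∀ N : ℕ, ∀ᶠ j in atTop, N₀ ≤ κ (φ j) ∧ (N : ℝ) ≤ s (φ j) := fun N =>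
    (hκφ.eventually_ge_atTop N₀).and (hsφ.eventually_ge_atTop (N : ℝ))
  have hwlim : ∀ N : ℕ, Tendsto (fun j => ye (κ (φ j)) (s (φ j) - N)) atTop (𝓝 (w N)) := by
    intro N
    refine (l3 N).congr' ?_
    filter_upwards [hev N] with j hj
    simp [hj]
  have hσlim : ∀ N : ℕ, Tendsto (fun j => σ (s (φ j) - N) g0) atTop (𝓝 (σ (-N) h)) := by
    intro N
    have := ((A.continuous_flow.comp (Continuous.prodMk_right (-(N : ℝ)))).tendsto h).comp l1
    refine this.congr fun j => ?_
    simp only [Function.comp_apply, ← A.flow_add]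
    congr 1; ring
  have hmem : ∀ N : ℕ, ∀ᶠ j in atTop, s (φ j) - N ∈ Icc 0 (t₀ / ε (κ (φ j))) := by
    intro N
    filter_upwards [hev N] with j hj
    exact ⟨by linarith [hj.2], by linarith [(hs (φ j)).2, N.cast_nonneg (α := ℝ)]⟩
  have hP : ∀ N : ℕ, σ (-N) h ∈ closure {h : H | ∃ τ ≥ 0, h = σ τ g0} := fun N =>
    mem_closure_of_tendsto (hσlim N) ((hmem N).mono fun j hj => ⟨_, hj.1, rfl⟩)
  have hεlim : ∀ N : ℕ, Tendsto (fun j => ε (κ (φ j)) * (s (φ j) - N)) atTop (𝓝 t) := by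
    intro N
    have h1 := (A.lim.comp hκφ).mul_const (N : ℝ)
    rw [zero_mul] at h1
    simpa [mul_sub] using l2.sub h1
  choose v hv0 hv using fun N : ℕ => A.exists_solution _ (hP N) (x0 t) (w N)
  have htrack : ∀ (N : ℕ) (η : ℝ), 0 < η → ∀ᶠ j in atTop, ∀ s' ∈ Icc (0 : ℝ) N,
      s (φ j) - N + s' ≤ t₀ / ε (κ (φ j)) →
      dist (ye (κ (φ j)) (s (φ j) - N + s')) (v N s') < η := fun N η hη =>
    A.eventually_dist_lt hκφ (hmem N) (hσlim N) ht (hεlim N) (hv N)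
      (by rw [hv0]; exact hwlim N) N hη
  have hmatch : ∀ N N' : ℕ, N ≤ N' → v N' (N' - N) = v N 0 := by
    intro N N' hNN
    have hNN' : (N : ℝ) ≤ N' := by exact_mod_cast hNN
    rw [hv0]
    refine tendsto_nhds_unique (Metric.tendsto_nhds.2 fun η hη => ?_) (hwlim N)
    filter_upwards [htrack N' η hη] with j hj
    have := hj (N' - N) ⟨by linarith, by linarith [N.cast_nonneg (α := ℝ)]⟩
      (by linarith [(hs (φ j)).2, N.cast_nonneg (α := ℝ)])
    rwa [show s (φ j) - (N' : ℝ) + (N' - N) = s (φ j) - N by ring] at this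
  obtain ⟨c, hc⟩ := A.norm_le
  obtain ⟨T, -, hT⟩ := hc (|R| + 1) (by positivity)
  obtain ⟨y, hy0, hyb, hy⟩ := A.exists_entire_solution hv hmatch (c := c) (T := T)
    fun N => hT _ ⟨t, ht, rfl⟩ _ (hP N) _ (hv N) (by
      rw [hv0]; simpa using hw N (mem_univ N))
  have hω : h ∈ omegaSet σ g0 := by
    simp only [omegaSet, mem_iInter]
    exact fun a _ => mem_closure_of_tendsto l1
      ((hsφ.eventually_ge_atTop a).mono fun j hj => ⟨_, hj, rfl⟩)
  have hx0lim : Tendsto (fun j => x0 (ε (κ (φ j)) * s (φ j))) atTop (𝓝 (x0 t)) :=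
    (hx0 t ht).tendsto.comp (tendsto_nhdsWithin_iff.2
      ⟨l2, Eventually.of_forall fun j => A.mul_mem_Icc (hs0 _)⟩)
  have hylim := hwlim 0
  simp only [Nat.cast_zero, sub_zero] at hylim
  obtain ⟨j, j1, j2, j3⟩ := ((Metric.tendsto_nhds.1 l1 η hη).and
    ((Metric.tendsto_nhds.1 hx0lim η hη).and (Metric.tendsto_nhds.1 hylim η hη))).exists
  obtain ⟨τ, hτ⟩ := hcon (φ j) h hω _ ⟨t, ht, rfl⟩ j1 j2 (w 0) j3 y (hy0.trans (hv0 0)) hyb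
  exact hτ (hy τ)

end FastFamily

theorem isLocallyUniformlyLipschitz_of_mem_closure {n m : ℕ}
    {g h : C(EuclideanSpace ℝ (Fin n) × EuclideanSpace ℝ (Fin m) × ℝ, EuclideanSpace ℝ (Fin m))}
    (hlip : IsLipschitzInY g) (hh : h ∈ closure {h | ∃ s : ℝ, h = timeTranslate s g}) :
    IsLocallyUniformlyLipschitz h := by
  intro x R
  obtain ⟨L, hL, hgL⟩ := hlip {x} isCompact_singleton _ (isCompact_closedBall 0 R)
  refine ⟨L.toNNReal, fun t => LipschitzOnWith.of_dist_le_mul fun y₁ hy₁ y₂ hy₂ => ?_⟩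
  have hclosed : IsClosed {h : C(EuclideanSpace ℝ (Fin n) × EuclideanSpace ℝ (Fin m) × ℝ,
      EuclideanSpace ℝ (Fin m)) | dist (h (x, y₁, t)) (h (x, y₂, t)) ≤ L * dist y₁ y₂} :=
    isClosed_le ((continuous_eval_const _).dist (continuous_eval_const _)) continuous_const
  rw [Real.coe_toNNReal _ hL.le]
  refine closure_minimal ?_ hclosed hh
  rintro _ ⟨s, rfl⟩
  simpa [timeTranslate, dist_eq_norm] using hgL x rfl y₁ hy₁ y₂ hy₂ (t + s)

theorem mem_orbit_or_mem_omegaSet {H : Type*} [TopologicalSpace H] [T2Space H] {σ : ℝ → H → H}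
    {g0 : H} (hσ : Continuous fun s => σ s g0) {h : H}
    (hh : h ∈ closure {h : H | ∃ τ ≥ 0, h = σ τ g0}) :
    (∃ s ≥ 0, h = σ s g0) ∨ h ∈ omegaSet σ g0 := by
  by_contra! hcon
  obtain ⟨horb, hω⟩ := hcon
  simp only [omegaSet, mem_iInter, not_forall] at hω
  obtain ⟨a, ha, hna⟩ := hω
  have hsub : {h : H | ∃ τ ≥ 0, h = σ τ g0} ⊆
      ((fun s => σ s g0) '' Icc 0 a) ∪ {h : H | ∃ τ ≥ a, h = σ τ g0} := by
    rintro _ ⟨τ, hτ, rfl⟩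
    rcases le_total τ a with hle | hle
    · exact Or.inl ⟨τ, ⟨hτ, hle⟩, rfl⟩
    · exact Or.inr ⟨τ, hle, rfl⟩
  have := closure_mono hsub hh
  rw [closure_union, (isCompact_Icc.image hσ).isClosed.closure_eq] at this
  rcases this with ⟨s, hs, rfl⟩ | hc
  · exact horb s hs.1 rfl
  · exact hna hc

theorem exists_dist_slow_lt {E : Type*} [PseudoMetricSpace E] {ε : ℕ → ℝ} (hε : ∀ k, 0 < ε k)
    {t₀ : ℝ} {xe : ℕ → ℝ → E} {x0 : ℝ → E} (hx0 : ContinuousOn x0 (Icc 0 t₀))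
    (hconv : TendstoUniformlyOn (fun k t => xe k (t / ε k)) x0 atTop (Icc 0 t₀))
    {t : ℝ} (ht : t ∈ Icc 0 t₀) {ρ : ℝ} (hρ : 0 < ρ) :
    ∃ κ > 0, ∀ᶠ k in atTop, ∀ τ ∈ Icc 0 (t₀ / ε k),
      dist (ε k * τ) t < κ → dist (xe k τ) (x0 t) < ρ := by
  obtain ⟨κ, hκ, hκ'⟩ := Metric.continuousOn_iff.1 hx0 t ht (ρ / 2) (half_pos hρ)
  refine ⟨κ, hκ, ?_⟩
  filter_upwards [Metric.tendstoUniformlyOn_iff.1 hconv (ρ / 2) (half_pos hρ)] with k hk τ hτ hd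
  have hmem : ε k * τ ∈ Icc 0 t₀ :=
    ⟨mul_nonneg (hε k).le hτ.1, by linarith [(le_div_iff₀ (hε k)).1 hτ.2]⟩
  have h1 := hk _ hmem
  rw [mul_div_cancel_left₀ _ (hε k).ne', dist_comm] at h1
  linarith [dist_triangle (xe k τ) (x0 (ε k * τ)) (x0 t), hκ' _ hmem hd]

/-- Equicontinuity of a flow on a compact space over a compact time interval. -/
theorem exists_dist_flow_lt {H : Type*} [MetricSpace H] [CompactSpace H] {σ : ℝ → H → H}
    (hσ : Continuous fun p : ℝ × H => σ p.1 p.2) (a b : ℝ) {η : ℝ} (hη : 0 < η) :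
    ∃ κ > 0, ∀ s ∈ Icc a b, ∀ h h', dist h h' < κ → dist (σ s h) (σ s h') < η := by
  obtain ⟨κ, hκ, hκ'⟩ := Metric.uniformContinuousOn_iff.1
    ((isCompact_Icc (a := a) (b := b)).prod
      (isCompact_univ (X := H)) |>.uniformContinuousOn_of_continuous hσ.continuousOn) η hη
  exact ⟨κ, hκ, fun s hs h h' hd => hκ' (s, h) ⟨hs, mem_univ _⟩ (s, h') ⟨hs, mem_univ _⟩
    (by simpa [Prod.dist_eq] using hd)⟩

theorem stmt_18
    {n m : ℕ} (hn : 1 ≤ n) (hm : 1 ≤ m)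
    -- g, admissible and Lipschitz in y on compacts
    (g : C(EuclideanSpace ℝ (Fin n) × EuclideanSpace ℝ (Fin m) × ℝ,
      EuclideanSpace ℝ (Fin m)))
    (hadm : IsAdmissibleMap g) (hlip : IsLipschitzInY g)
    -- the hull H of g, a compact metric space with the continuous shift flow,
    -- identified via the embedding ev with the closure of the translates of g
    (H : Type) [MetricSpace H] [CompactSpace H]
    (σf : ℝ → H → H)
    (hσcont : Continuous fun p : ℝ × H => σf p.1 p.2)
    (hσ0 : ∀ h, σf 0 h = h)
    (hσadd : ∀ s t : ℝ, ∀ h, σf (s + t) h = σf s (σf t h))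
    (ev : H → C(EuclideanSpace ℝ (Fin n) × EuclideanSpace ℝ (Fin m) × ℝ,
      EuclideanSpace ℝ (Fin m)))
    (hev : Topology.IsEmbedding ev)
    (hrange : Set.range ev = closure {h | ∃ s : ℝ, h = timeTranslate s g})
    (g0 : H) (hg0 : ev g0 = g)
    (hequiv : ∀ (s : ℝ) (h : H), ev (σf s h) = timeTranslate s (ev h))
    -- the (unique, maximal) solutions y(τ,h,x,τ₀,y₀) of y' = h(x,y,τ)
    (sol : H → EuclideanSpace ℝ (Fin n) → ℝ → EuclideanSpace ℝ (Fin m) → ℝ →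
      EuclideanSpace ℝ (Fin m))
    (hsolinit : ∀ h x τ₀ y₀, sol h x τ₀ y₀ τ₀ = y₀)
    -- (H1'): solutions over the forward orbit of g and over O(g) are globally
    -- defined in the future
    (hsolodeO : ∀ h ∈ omegaSet σf g0, ∀ x (τ₀ : ℝ) y₀ (τ : ℝ), τ₀ ≤ τ →
      HasDerivAt (sol h x τ₀ y₀) (ev h (x, sol h x τ₀ y₀ τ, τ)) τ)
    (hsolodeG : ∀ s : ℝ, 0 ≤ s → ∀ x (τ₀ : ℝ) y₀ (τ : ℝ), 0 ≤ τ₀ → τ₀ ≤ τ →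
      HasDerivAt (sol (σf s g0) x τ₀ y₀) (ev (σf s g0) (x, sol (σf s g0) x τ₀ y₀ τ, τ)) τ)
    -- (H2'): uniform ultimate boundedness on [0,∞) over compact sets of parameters
    (hH2' : ∀ K₀ : Set (EuclideanSpace ℝ (Fin n)), IsCompact K₀ →
      ∃ c > (0:ℝ), ∀ d > (0:ℝ), ∃ T > (0:ℝ), ∀ x ∈ K₀, ∀ τ₀ : ℝ, 0 ≤ τ₀ → ∀ τ ≥ T,
        ∀ y₀ : EuclideanSpace ℝ (Fin m), ‖y₀‖ ≤ d → ‖sol g0 x τ₀ y₀ (τ + τ₀)‖ ≤ c)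
    -- the slow vector field f, continuous and of linear growth
    (f : EuclideanSpace ℝ (Fin n) → EuclideanSpace ℝ (Fin m) → EuclideanSpace ℝ (Fin n))
    (hf : Continuous fun p : EuclideanSpace ℝ (Fin n) × EuclideanSpace ℝ (Fin m) =>
      f p.1 p.2)
    (a b : ℝ) (ha : 0 < a) (hb : 0 < b)
    (hgrowth : ∀ x y, ‖f x y‖ ≤ a + b * ‖x‖)
    -- initial data, final slow time, the sequence ε_k ↓ 0, and the solutions
    -- (x_{ε_k}, y_{ε_k}) of the slow-fast system in the fast time
    (xInit : EuclideanSpace ℝ (Fin n)) (yInit : EuclideanSpace ℝ (Fin m))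
    (t₀ : ℝ) (ht₀ : 0 < t₀)
    (ε : ℕ → ℝ) (hεpos : ∀ k, 0 < ε k) (hεanti : StrictAnti ε)
    (hεlim : Tendsto ε atTop (𝓝 0))
    (xe : ℕ → ℝ → EuclideanSpace ℝ (Fin n)) (ye : ℕ → ℝ → EuclideanSpace ℝ (Fin m))
    (hxe0 : ∀ k, xe k 0 = xInit) (hye0 : ∀ k, ye k 0 = yInit)
    (hxeode : ∀ k : ℕ, ∀ τ ∈ Set.Icc (0:ℝ) (t₀ / ε k),
      HasDerivAt (xe k) (ε k • f (xe k τ) (ye k τ)) τ)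
    (hyeode : ∀ k : ℕ, ∀ τ ∈ Set.Icc (0:ℝ) (t₀ / ε k),
      HasDerivAt (ye k) (g (xe k τ, ye k τ, τ)) τ)
    -- the slow components converge uniformly (in the slow time) to x₀
    (x0 : ℝ → EuclideanSpace ℝ (Fin n)) (hx0cont : ContinuousOn x0 (Set.Icc 0 t₀))
    (hconv : TendstoUniformlyOn (fun k t => xe k (t / ε k)) x0 atTop (Set.Icc 0 t₀))
    -- the radius of the compact tube K₀ around x₀
    (r : ℝ) (hr : 0 < r)
    (δ : ℝ) (hδ : 0 < δ) :
    ∃ T > (0:ℝ), ∃ τ₀ > (0:ℝ), ∃ δt : ℝ, 0 < δt ∧ δt ≤ δ ∧ ∃ k₀ : ℕ,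
      τ₀ + 2 * T < t₀ / ε k₀ ∧
      ∀ hseq : ℕ → H,
        (∀ i : ℕ, hseq i ∈ omegaSet σf g0 ∧ dist (σf (τ₀ + i * T) g0) (hseq i) < δt) →
        ∀ k ≥ k₀, ∀ i : ℕ,
          ∀ τ ∈ Set.Icc (τ₀ + ((i:ℝ) + 1) * T) (τ₀ + ((i:ℝ) + 2) * T) ∩
              Set.Icc (τ₀ + T) (t₀ / ε k),
            Metric.infDist (ye k τ)
              (inflFiberO ev σf g0 (slowTube x0 t₀ r)
                (σf (τ - τ₀ - i * T) (hseq i)) (x0 (ε k * τ)) δ) ≤ δ := by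
  have hshift : ∀ s h x y t, ev (σf s h) (x, y, t) = ev h (x, y, t + s) := fun s h x y t => by
    rw [hequiv]; rfl
  have A : FastFamily σf ev g0 ε t₀ x0 xe ye :=
    { continuous_ev := hev.continuous
      continuous_flow := hσcont
      flow_add := hσadd
      ev_flow := hshift
      lipschitz := fun h => isLocallyUniformlyLipschitz_of_mem_closure hlip
        (hrange ▸ mem_range_self h)
      exists_solution := fun h hh x y => by
        refine ⟨sol h x 0 y, hsolinit _ _ _ _, fun s hs => ?_⟩
        rcases mem_orbit_or_mem_omegaSet (σ := σf) (hσcont.comp (Continuous.prodMk_left g0)) hh with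
          ⟨a, ha, rfl⟩ | hω
        · exact hsolodeG a ha x 0 y s le_rfl hs
        · exact hsolodeO h hω x 0 y s hs
      dissipative := by
        obtain ⟨c, -, hc⟩ := hH2' (x0 '' Icc 0 t₀) (isCompact_Icc.image_of_continuousOn hx0cont)
        refine ⟨c, fun d hd => ?_⟩
        obtain ⟨T, hT, hcT⟩ := hc d hd
        refine ⟨T, hT, fun x hx s hs y hy => ⟨fun t => sol g0 x s y (t + s), ?_, fun t ht => ?_,
          fun τ hτ => hcT x hx s hs τ hτ y hy⟩⟩
        · simp [hsolinit]
        · have := hsolodeG 0 le_rfl x s y (t + s) hs (by linarith)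
          rw [hσ0] at this
          rw [hshift]
          exact this.comp_add_const t s
      pos := hεpos
      lim := hεlim
      hasDerivAt := fun k τ hτ => by rw [hg0]; exact hyeode k τ hτ
      slow := fun t ht ρ hρ => exists_dist_slow_lt hεpos hx0cont hconv ht hρ }
  obtain ⟨N, hN⟩ := A.exists_near_entire_solution hye0 hx0cont (half_pos hδ)
  have hT : (0 : ℝ) < N + 1 := by positivity
  set T : ℝ := N + 1 with hTdef
  obtain ⟨κ, hκ, hκ'⟩ := exists_dist_flow_lt hσcont T (2 * T) (half_pos hδ)
  have htop : Tendsto (fun k => t₀ / ε k) atTop atTop :=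
    (tendsto_nhdsWithin_iff.2 ⟨hεlim, Eventually.of_forall hεpos⟩).inv_tendsto_nhdsGT_zero
      |>.const_mul_atTop ht₀
  obtain ⟨k₀, hk₀, hNk₀⟩ := ((htop.eventually_gt_atTop (1 + 2 * T)).and
    (eventually_ge_atTop N)).exists
  refine ⟨T, hT, 1, one_pos, min κ δ, lt_min hκ hδ, min_le_right _ _, k₀, hk₀, ?_⟩
  rintro hseq hh k hk i τ ⟨⟨hτ1, hτ2⟩, hτ3, hτ4⟩
  obtain ⟨h, hω, x, ⟨t, ht, rfl⟩, hdh, hdx, z, hz, y, hy0, hyb, hy⟩ :=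
    hN k (hNk₀.trans hk) τ ⟨by linarith, hτ4⟩
  have hflow : dist (σf (τ - 1 - i * T) (σf (1 + i * T) g0)) (σf (τ - 1 - i * T) (hseq i)) <
      δ / 2 :=
    hκ' _ ⟨by linarith, by linarith⟩ _ _ ((hh i).2.trans_le (min_le_left _ _))
  rw [← hσadd, show τ - 1 - i * T + (1 + i * T) = τ by ring, dist_comm] at hflow
  have hmem : z ∈ inflFiberO ev σf g0 (slowTube x0 t₀ r) (σf (τ - 1 - i * T) (hseq i))
      (x0 (ε k * τ)) δ := by
    refine mem_iUnion₂.2 ⟨(h, x0 t), ⟨hω, ⟨t, ht, 0, by simpa using hr.le, by simp⟩,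
      max_le ?_ (by linarith)⟩, y, hy0, hyb, hy⟩
    exact (dist_triangle _ _ _).trans (by linarith)
  exact (infDist_le_dist_of_mem hmem).trans (by linarith)
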